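/- Let E ⊆ H be a Lebesgue-measurable monotone set: for Lebesgue-almost every (g,(a,b)) ∈ H × (ℝ²∖{0}), the set {t ∈ ℝ : g·(ta, tb, t²ab/2) ∈ E} ⊆ ℝ is monotone, i.e. agrees up to a Lebesgue-null set with ∅, ℝ, or a half-line. Then, up to a Lebesgue-null set of ℝ³, either E = ∅, or E = H, or E is a half-space of H. -/

import Mathlib

open MeasureTheory Set Topology Filter

noncomputable section

/-- The Heisenberg group as a set: `ℝ³`. -/
abbrev Heis : Type := ℝ × ℝ × ℝ

/-- The Heisenberg group multiplication
`(a,b,c)·(a',b',c') = (a+a', b+b', c+c'+a·b')`. -/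
def hMul (x y : Heis) : Heis :=
  (x.1 + y.1, x.2.1 + y.2.1, x.2.2 + y.2.2 + x.1 * y.2.1)

/-- The abelianization homomorphism `π : H → ℝ²`, `π(a,b,c) = (a,b)`. -/
def hPi (x : Heis) : ℝ × ℝ := (x.1, x.2.1)

/-- The (horizontal) line of the Heisenberg group through `g` with direction `(a,b)`:
`{g·(ta, tb, t²ab/2) : t ∈ ℝ}`. -/
def hLine (g : Heis) (a b : ℝ) : Set Heis :=
  {p | ∃ t : ℝ, p = hMul g (t * a, t * b, t ^ 2 * a * b / 2)}

/-- A subset of the Heisenberg group is a (horizontal) line. -/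
def IsLine (L : Set Heis) : Prop :=
  ∃ g : Heis, ∃ a b : ℝ, ¬(a = 0 ∧ b = 0) ∧ L = hLine g a b

/-- Two lines of `H` are parallel if their `π`-images are parallel straight lines
in `ℝ²`, i.e. their direction vectors are linearly dependent. -/
def AreParallelLines (L₁ L₂ : Set Heis) : Prop :=
  ∃ g₁ g₂ : Heis, ∃ a₁ b₁ a₂ b₂ : ℝ,
    ¬(a₁ = 0 ∧ b₁ = 0) ∧ ¬(a₂ = 0 ∧ b₂ = 0) ∧
    L₁ = hLine g₁ a₁ b₁ ∧ L₂ = hLine g₂ a₂ b₂ ∧ a₁ * b₂ = a₂ * b₁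

/-- Two lines of `H` are skew if they are disjoint and not parallel. -/
def AreSkewLines (L₁ L₂ : Set Heis) : Prop :=
  IsLine L₁ ∧ IsLine L₂ ∧ Disjoint L₁ L₂ ∧ ¬ AreParallelLines L₁ L₂

/-- A straight line in `ℝ²`. -/
def IsLineR2 (l : Set (ℝ × ℝ)) : Prop :=
  ∃ p v : ℝ × ℝ, v ≠ 0 ∧ l = {q | ∃ t : ℝ, q = p + t • v}

/-- The horizontal plane centered at `g`: the union of all lines through `g`. -/
def horizPlane (g : Heis) : Set Heis :=
  {p | ∃ L : Set Heis, IsLine L ∧ g ∈ L ∧ p ∈ L}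

/-- A plane of the Heisenberg group: a vertical plane `π⁻¹(ℓ)` for a straight line
`ℓ ⊂ ℝ²`, or a horizontal plane. -/
def IsPlane (P : Set Heis) : Prop :=
  (∃ l : Set (ℝ × ℝ), IsLineR2 l ∧ P = hPi ⁻¹' l) ∨ (∃ g : Heis, P = horizPlane g)

/-- A half-space of the Heisenberg group: a connected component of the complement
of a plane. -/
def IsHalfSpace (C : Set Heis) : Prop :=
  ∃ P : Set Heis, ∃ x : Heis, IsPlane P ∧ x ∉ P ∧ C = connectedComponentIn Pᶜ x

/-- A measurable set `S ⊆ ℝ` is monotone if, up to a Lebesgue-null set, it is `∅`,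
`ℝ`, or a half-line. -/
def IsMonotoneSubsetR (S : Set ℝ) : Prop :=
  volume (symmDiff S (∅ : Set ℝ)) = 0 ∨ volume (symmDiff S (Set.univ : Set ℝ)) = 0 ∨
    ∃ r : ℝ, volume (symmDiff S (Set.Ioi r)) = 0 ∨ volume (symmDiff S (Set.Iio r)) = 0

/-- Right translation by the horizontal element with projection `v`, in the coordinates
`(a, b, 2 * c - a * b)`, in which horizontal lines are straight. -/
def slide (p : Heis) (v : ℝ × ℝ) : Heis :=
  (p.1 + v.1, p.2.1 + v.2, p.2.2 + (p.1 * v.2 - p.2.1 * v.1))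

lemma slide_slide_smul (p : Heis) (v : ℝ × ℝ) (s t : ℝ) :
    slide (slide p (s • v)) (t • v) = slide p ((s + t) • v) := by
  ext <;> simp [slide] <;> ring

@[simp] lemma slide_zero (p : Heis) : slide p 0 = p := by
  ext <;> simp [slide]

lemma continuous_slide : Continuous fun x : Heis × (ℝ × ℝ) => slide x.1 x.2 := by
  unfold slide; fun_prop

@[fun_prop] lemma Continuous.slide {X : Type*} [TopologicalSpace X] {f : X → Heis}
    {g : X → ℝ × ℝ} (hf : Continuous f) (hg : Continuous g) :
    Continuous fun x => slide (f x) (g x) :=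
  continuous_slide.comp (hf.prodMk hg)

lemma Filter.Tendsto.slide {X : Type*} {l : Filter X} {f : X → Heis} {g : X → ℝ × ℝ}
    {p : Heis} {v : ℝ × ℝ} (hf : Tendsto f l (𝓝 p)) (hg : Tendsto g l (𝓝 v)) :
    Tendsto (fun x => _root_.slide (f x) (g x)) l (𝓝 (_root_.slide p v)) :=
  (continuous_slide.tendsto (p, v)).comp (hf.prodMk_nhds hg)

/-- A pair of disjoint regular open sets with dense union such that no horizontal line meets
them alternately three times. -/
structure IsMonotonePair (U V : Set Heis) : Prop where
  isOpen_left : IsOpen U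
  isOpen_right : IsOpen V
  disjoint : Disjoint U V
  subset_left : ∀ W, IsOpen W → Disjoint W V → W ⊆ U
  subset_right : ∀ W, IsOpen W → Disjoint W U → W ⊆ V
  notMem_right : ∀ p v, ∀ s < (0 : ℝ), ∀ t > (0 : ℝ),
    slide p (s • v) ∈ U → slide p (t • v) ∈ U → p ∉ V
  notMem_left : ∀ p v, ∀ s < (0 : ℝ), ∀ t > (0 : ℝ),
    slide p (s • v) ∈ V → slide p (t • v) ∈ V → p ∉ U

namespace IsMonotonePair

variable {U V : Set Heis}

lemma symm (h : IsMonotonePair U V) : IsMonotonePair V U :=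
  ⟨h.isOpen_right, h.isOpen_left, h.disjoint.symm, h.subset_right, h.subset_left,
    h.notMem_left, h.notMem_right⟩

lemma mem_closure_right (h : IsMonotonePair U V) {p : Heis} (hp : p ∉ U) : p ∈ closure V := by
  by_contra hc
  exact hp (h.subset_left (closure V)ᶜ isClosed_closure.isOpen_compl
    (disjoint_compl_left.mono_right subset_closure) hc)

lemma slide_mem_right_of_mem (h : IsMonotonePair U V) {p : Heis} {v : ℝ × ℝ} {s t : ℝ}
    (hs : s < 0) (ht : 0 < t) (hU : slide p (s • v) ∈ U) (hp : p ∈ V) :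
    slide p (t • v) ∈ V := by
  have h1 : Continuous fun w => slide w ((-t) • v) := by fun_prop
  have h2 : Continuous fun w => slide w ((s - t) • v) := by fun_prop
  refine h.subset_right _ ((h.isOpen_right.preimage h1).inter (h.isOpen_left.preimage h2))
    (Set.disjoint_left.2 ?_) ⟨?_, ?_⟩
  · rintro w ⟨hwV, hwU⟩ hw
    refine h.notMem_right (slide w ((-t) • v)) v s hs t ht ?_ ?_ hwV
    · rw [slide_slide_smul, neg_add_eq_sub]; exact hwU
    · rw [slide_slide_smul]; simpa using hw
  · rw [mem_preimage, slide_slide_smul]; simpa using hp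
  · rw [mem_preimage, slide_slide_smul]; simpa using hU

/-- A point which is not interior to `U` and sees a point of `U` in one horizontal direction only
sees points of `V` in the opposite direction. -/
lemma slide_mem_right (h : IsMonotonePair U V) {p : Heis} {v : ℝ × ℝ} {s t : ℝ}
    (hs : s < 0) (ht : 0 < t) (hU : slide p (s • v) ∈ U) (hp : p ∉ U) :
    slide p (t • v) ∈ V := by
  wlog ht1 : t = 1 generalizing v s t
  · have := this (v := t • v) (s := s / t) (t := 1) (div_neg_of_neg_of_pos hs ht) one_pos
      (by rwa [smul_smul, div_mul_cancel₀ _ ht.ne']) rfl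
    rwa [one_smul] at this
  subst ht1
  rw [one_smul]
  set b := slide p v with hb
  have hv : v ≠ 0 := by
    rintro rfl; simp at hU; exact hp hU
  let D : Heis → ℝ × ℝ := fun w => (b.1 - w.1, b.2.1 - w.2.1)
  let N : Heis → ℝ := fun w => (D w).1 ^ 2 + (D w).2 ^ 2
  let k : Heis → ℝ := fun w => (b.2.2 - w.2.2 - (w.1 * b.2.1 - w.2.1 * b.1)) / N w
  let e : Heis → ℝ × ℝ := fun w => k w • ((D w).2, -(D w).1)
  let f : Heis → ℝ × ℝ := fun w => (1 / 2 : ℝ) • D w + e w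
  let g : Heis → ℝ × ℝ := fun w => (1 / 2 : ℝ) • D w - e w
  have hDp : D p = v := by ext <;> simp [D, hb, slide]
  have hNp : N p ≠ 0 := by
    intro h0
    simp only [N, hDp] at h0
    exact hv (Prod.ext (by nlinarith [sq_nonneg v.1, sq_nonneg v.2] : v.1 = 0)
      (by nlinarith [sq_nonneg v.1, sq_nonneg v.2] : v.2 = 0))
  have hkp : k p = 0 := by
    simp only [k, hb, slide]; apply div_eq_zero_iff.2; left; ring
  have hD : Continuous D := by fun_prop
  have hN : Continuous N := by fun_prop
  have hk : Tendsto k (𝓝 p) (𝓝 0) := by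
    rw [← hkp]
    exact ContinuousAt.div (by fun_prop) hN.continuousAt hNp
  have hDt : Tendsto D (𝓝 p) (𝓝 v) := hDp ▸ hD.tendsto p
  have he : Tendsto e (𝓝 p) (𝓝 0) := by
    have : Tendsto e (𝓝 p) (𝓝 ((0 : ℝ) • ((D p).2, -(D p).1))) :=
      hk.smul (Continuous.tendsto (by fun_prop) p)
    simpa using this
  have hf : Tendsto f (𝓝 p) (𝓝 ((1 / 2 : ℝ) • v)) := by
    simpa only [add_zero] using (hDt.const_smul (1 / 2 : ℝ)).add he
  have hg : Tendsto g (𝓝 p) (𝓝 ((1 / 2 : ℝ) • v)) := by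
    simpa only [sub_zero] using (hDt.const_smul (1 / 2 : ℝ)).sub he
  have e1 : ∀ᶠ w in 𝓝 p, slide w ((2 * s) • f w) ∈ U := by
    refine (tendsto_id.slide (hf.const_smul (2 * s))).eventually_mem (h.isOpen_left.mem_nhds ?_)
    rw [smul_smul]; convert hU using 3; ring
  have e2 : ∀ᶠ w in 𝓝 p, slide (slide w (f w)) ((2 * s - 1) • g w) ∈ U := by
    refine ((tendsto_id.slide hf).slide (hg.const_smul (2 * s - 1))).eventually_mem
      (h.isOpen_left.mem_nhds ?_)
    rw [smul_smul, slide_slide_smul]; convert hU using 3; ring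
  have e3 : ∀ᶠ w in 𝓝 p, N w ≠ 0 := hN.continuousAt.eventually_ne hNp
  obtain ⟨w, hwV, h1, h2, h3⟩ :=
    ((mem_closure_iff_frequently.1 (h.mem_closure_right hp)).and_eventually
      (e1.and (e2.and e3))).exists
  have hw1 : slide w (f w) ∈ V := by
    simpa using h.slide_mem_right_of_mem (by linarith : 2 * s < 0) one_pos h1 hwV
  have hw2 : slide (slide w (f w)) (g w) ∈ V := by
    simpa using h.slide_mem_right_of_mem (by linarith : 2 * s - 1 < 0) one_pos h2 hw1
  have hkN : k w * N w = b.2.2 - w.2.2 - (w.1 * b.2.1 - w.2.1 * b.1) := div_mul_cancel₀ _ h3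
  have hfin : slide (slide w (f w)) (g w) = b := by
    simp only [N, D] at hkN
    ext
    · simp [slide, f, g, D, e]; ring
    · simp [slide, f, g, D, e]; ring
    · simp [slide, f, g, D, e]; linear_combination hkN
  rwa [hfin] at hw2

/-- The common boundary of the two sets. -/
lemma slide_mem_of_boundary (h : IsMonotonePair U V) {p : Heis} {v : ℝ × ℝ}
    (hpU : p ∉ U) (hpV : p ∉ V) (hv : slide p v ∈ U) {t : ℝ} (ht : 0 < t) :
    slide p (t • v) ∈ U ∧ slide p ((-t) • v) ∈ V := by
  have h1 : ∀ t > (0 : ℝ), slide p (t • (-v)) ∈ V := fun t ht =>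
    h.slide_mem_right (s := -1) (by norm_num) ht (by simpa using hv) hpU
  refine ⟨h.symm.slide_mem_right (s := -1) (by norm_num) ht ?_ hpV, ?_⟩
  · simpa using h1 1 one_pos
  · simpa using h1 t ht

lemma slide_smul_notMem_left (h : IsMonotonePair U V) {p : Heis} {v : ℝ × ℝ}
    (hpU : p ∉ U) (hpV : p ∉ V) (hvU : slide p v ∉ U) (hvV : slide p v ∉ V) (t : ℝ) :
    slide p (t • v) ∉ U := by
  intro ht
  rcases lt_trichotomy t 0 with h0 | rfl | h0
  · refine hvV ?_
    have := (h.slide_mem_of_boundary hpU hpV ht (t := -t⁻¹) (by simpa using h0)).2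
    rwa [neg_neg, smul_smul, inv_mul_cancel₀ h0.ne, one_smul] at this
  · simp at ht; exact hpU ht
  · refine hvU ?_
    have := (h.slide_mem_of_boundary hpU hpV ht (t := t⁻¹) (by simpa using h0)).1
    rwa [smul_smul, inv_mul_cancel₀ h0.ne', one_smul] at this

/-- A horizontal line meeting the common boundary twice is contained in it. -/
lemma slide_smul_mem_boundary (h : IsMonotonePair U V) {p : Heis} {v : ℝ × ℝ}
    (hp : p ∈ (U ∪ V)ᶜ) (hv : slide p v ∈ (U ∪ V)ᶜ) (t : ℝ) :
    slide p (t • v) ∈ (U ∪ V)ᶜ := by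
  simp only [mem_compl_iff, mem_union, not_or] at hp hv ⊢
  exact ⟨h.slide_smul_notMem_left hp.1 hp.2 hv.1 hv.2 t,
    h.symm.slide_smul_notMem_left hp.2 hp.1 hv.2 hv.1 t⟩

/-- Every point of the common boundary lies on a horizontal line contained in it. -/
lemma exists_slide_mem_boundary (h : IsMonotonePair U V) {p : Heis} (hp : p ∈ (U ∪ V)ᶜ) :
    ∃ v : ℝ × ℝ, v ≠ 0 ∧ ∀ t : ℝ, slide p (t • v) ∈ (U ∪ V)ᶜ := by
  suffices ∃ v : ℝ × ℝ, v ≠ 0 ∧ slide p v ∈ (U ∪ V)ᶜ by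
    obtain ⟨v, hv, hpv⟩ := this
    exact ⟨v, hv, h.slide_smul_mem_boundary hp hpv⟩
  by_contra! hc
  have hpU : p ∉ U := fun h => hp (Or.inl h)
  have hpV : p ∉ V := fun h => hp (Or.inr h)
  have hcont : Continuous fun v => slide p v := by fun_prop
  have hcon : IsConnected ({0}ᶜ : Set (ℝ × ℝ)) :=
    isConnected_compl_singleton_of_one_lt_rank (by simp; norm_num) 0
  have hneg : ∀ v, slide p v ∈ U → slide p (-v) ∈ V := fun v hv => by
    simpa using (h.slide_mem_of_boundary hpU hpV hv one_pos).2
  have hneg' : ∀ v, slide p v ∈ V → slide p (-v) ∈ U := fun v hv => by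
    simpa using (h.symm.slide_mem_of_boundary hpV hpU hv one_pos).2
  have hcov : ({0}ᶜ : Set (ℝ × ℝ)) ⊆
      (fun v => slide p v) ⁻¹' U ∪ (fun v => slide p v) ⁻¹' V := by
    intro v hv
    have := hc v hv
    rwa [notMem_compl_iff] at this
  have hne : ∃ v : ℝ × ℝ, v ≠ 0 ∧ slide p v ∈ U := by
    have h1 : ((1, 0) : ℝ × ℝ) ≠ 0 := by simp
    rcases hcov h1 with h2 | h2
    · exact ⟨_, h1, h2⟩
    · exact ⟨_, neg_ne_zero.2 h1, hneg' _ h2⟩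
  obtain ⟨v, hv0, hv⟩ := hne
  obtain ⟨w, -, hwU, hwV⟩ := hcon.isPreconnected _ _ (h.isOpen_left.preimage hcont)
    (h.isOpen_right.preimage hcont) hcov ⟨v, hv0, hv⟩ ⟨-v, neg_ne_zero.2 hv0, hneg v hv⟩
  exact Set.disjoint_left.1 h.disjoint hwU hwV

end IsMonotonePair

/-- A set with empty interior containing every horizontal line that meets it twice. -/
structure IsLinearlyClosed (B : Set Heis) : Prop where
  interior_eq : interior B = ∅
  slide_mem : ∀ p ∈ B, ∀ v, slide p v ∈ B → ∀ t : ℝ, slide p (t • v) ∈ B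

/-- The quadric swept out by the horizontal lines joining two skew lines. -/
lemma mem_of_mul_eq {B : Set Heis}
    (hB : ∀ p ∈ B, ∀ v, slide p v ∈ B → ∀ t : ℝ, slide p (t • v) ∈ B)
    (h0 : ∀ t : ℝ, ((t, 0, 0) : Heis) ∈ B) (h1 : ∀ t : ℝ, ((0, t, 1) : Heis) ∈ B)
    {x y z : ℝ} (hxy : x * y = z * (1 - z)) (hz : z * (1 - z) ≠ 0) : ((x, y, z) : Heis) ∈ B := by
  have hz1 : 1 - z ≠ 0 := right_ne_zero_of_mul hz
  have hx : x ≠ 0 := left_ne_zero_of_mul (hxy ▸ hz)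
  have hy : y = z * (1 - z) / x := by field_simp; linarith
  have key := hB _ (h0 (x / (1 - z))) (-(x / (1 - z)), (1 - z) / x) (by
    convert h1 ((1 - z) / x) using 1
    ext
    · simp [slide]
    · simp [slide]
    · simp [slide]; field_simp) z
  convert key using 1
  ext
  · simp [slide]; field_simp; ring
  · simp [slide, hy]; ring
  · simp [slide]; field_simp

lemma mem_of_abs_lt {B : Set Heis}
    (hB : ∀ p ∈ B, ∀ v, slide p v ∈ B → ∀ t : ℝ, slide p (t • v) ∈ B)
    (h0 : ∀ t : ℝ, ((t, 0, 0) : Heis) ∈ B) (h1 : ∀ t : ℝ, ((0, t, 1) : Heis) ∈ B)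
    {x y z : ℝ} (hx : |x| < 1 / 10) (hy : |y| < 1 / 10) (hz : |z - 1 / 2| < 1 / 10) :
    ((x, y, z) : Heis) ∈ B := by
  rw [abs_lt] at hx hy hz
  let g : ℝ → ℝ := fun r => (x + r) * (y + r) - (z + r * (x - y)) * (1 - (z + r * (x - y)))
  have hg : Continuous g := by fun_prop
  have hmem : ∀ r, -1 ≤ r → r ≤ 1 → g r = 0 → slide (x, y, z) (r • (1, 1)) ∈ B := by
    intro r hr1 hr2 hr
    have hz1 : 0 < z + r * (x - y) := by nlinarith
    have hz2 : 0 < 1 - (z + r * (x - y)) := by nlinarith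
    have := mem_of_mul_eq hB h0 h1 (sub_eq_zero.1 hr) (mul_pos hz1 hz2).ne'
    convert this using 1
    ext <;> simp [slide]; ring
  have hg0 : g 0 < 0 := by simp only [g]; nlinarith
  have hg1 : 0 < g 1 := by simp only [g]; nlinarith [sq_nonneg (z + 1 * (x - y) - 1 / 2)]
  have hg2 : 0 < g (-1) := by simp only [g]; nlinarith [sq_nonneg (z + -1 * (x - y) - 1 / 2)]
  obtain ⟨r, ⟨hr1, hr2⟩, hr⟩ := intermediate_value_Icc (by norm_num : (0 : ℝ) ≤ 1)
    hg.continuousOn ⟨hg0.le, hg1.le⟩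
  obtain ⟨q, ⟨hq1, hq2⟩, hq⟩ := intermediate_value_Icc' (by norm_num : (-1 : ℝ) ≤ 0)
    hg.continuousOn ⟨hg0.le, hg2.le⟩
  have hr0 : r ≠ 0 := by rintro rfl; exact hg0.ne hr
  have hrq : r - q ≠ 0 := by
    have : 0 < r := lt_of_le_of_ne hr1 hr0.symm
    intro h; linarith
  have key := hB _ (hmem q hq1 (by linarith) hq) ((r - q) • (1, 1)) (by
    rw [slide_slide_smul]; convert hmem r (by linarith) hr2 hr using 3; ring) (-q / (r - q))
  rw [smul_smul, slide_slide_smul, div_mul_cancel₀ _ hrq] at key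
  simpa using key

namespace IsLinearlyClosed

variable {B : Set Heis}

/-- Two lines contained in `B` with independent directions over the same point of the plane
coincide there. -/
lemma eq_zero_of_lines (hB : IsLinearlyClosed B) (p : Heis) (v w : ℝ × ℝ) (h : ℝ)
    (hvw : v.1 * w.2 - v.2 * w.1 ≠ 0) (hv : ∀ t : ℝ, slide p (t • v) ∈ B)
    (hw : ∀ t : ℝ, slide (p.1, p.2.1, p.2.2 + h) (t • w) ∈ B) : h = 0 := by
  by_contra hh
  wlog hd : v.1 * w.2 - v.2 * w.1 = h generalizing w
  · refine this ((h / (v.1 * w.2 - v.2 * w.1)) • w) ?_ ?_ ?_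
    · simp only [Prod.smul_fst, Prod.smul_snd, smul_eq_mul]
      convert hh using 1
      field_simp
    · intro t; rw [smul_smul]; exact hw _
    · simp only [Prod.smul_fst, Prod.smul_snd, smul_eq_mul]
      field_simp
  let φ : Heis → Heis := fun c => (p.1 + (c.1 * v.1 + c.2.1 * w.1), p.2.1 + (c.1 * v.2 + c.2.1 * w.2),
    p.2.2 + h * c.2.2 + (p.1 * (c.1 * v.2 + c.2.1 * w.2) - p.2.1 * (c.1 * v.1 + c.2.1 * w.1)))
  let ψ : Heis → Heis := fun q => (((q.1 - p.1) * w.2 - (q.2.1 - p.2.1) * w.1) / h,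
    (v.1 * (q.2.1 - p.2.1) - v.2 * (q.1 - p.1)) / h,
    (q.2.2 - p.2.2 - (p.1 * (q.2.1 - p.2.1) - p.2.1 * (q.1 - p.1))) / h)
  have hφψ : ∀ q, φ (ψ q) = q := by
    intro q
    have e1 : (ψ q).1 * v.1 + (ψ q).2.1 * w.1 = q.1 - p.1 := by
      simp only [ψ]; field_simp; rw [← hd]; ring
    have e2 : (ψ q).1 * v.2 + (ψ q).2.1 * w.2 = q.2.1 - p.2.1 := by
      simp only [ψ]; field_simp; rw [← hd]; ring
    have e3 : h * (ψ q).2.2 = q.2.2 - p.2.2 - (p.1 * (q.2.1 - p.2.1) - p.2.1 * (q.1 - p.1)) := by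
      simp only [ψ]; field_simp
    simp only [φ, e1, e2, e3]
    ext
    · simp
    · simp
    · simp; ring
  have hψφ : ψ (φ (0, 0, 1 / 2)) = (0, 0, 1 / 2) := by
    ext
    · simp [φ, ψ]
    · simp [φ, ψ]
    · simp [φ, ψ]; field_simp
  have hψ : Continuous ψ := by fun_prop
  have hφs : ∀ c u, φ (slide c u) = slide (φ c) (u.1 • v + u.2 • w) := by
    intro c u
    ext
    · simp [φ, slide]; ring
    · simp [φ, slide]; ring
    · simp [φ, slide, ← hd]; ring
  have hB' : ∀ c ∈ φ ⁻¹' B, ∀ u, slide c u ∈ φ ⁻¹' B → ∀ t : ℝ, slide c (t • u) ∈ φ ⁻¹' B := by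
    intro c hc u hu t
    rw [mem_preimage, hφs] at hu ⊢
    convert hB.slide_mem _ hc _ hu t using 2
    ext <;> simp <;> ring
  have h0 : ∀ t : ℝ, ((t, 0, 0) : Heis) ∈ φ ⁻¹' B := by
    intro t
    rw [mem_preimage]
    convert hv t using 1
    ext <;> simp [φ, slide]
  have h1 : ∀ t : ℝ, ((0, t, 1) : Heis) ∈ φ ⁻¹' B := by
    intro t
    rw [mem_preimage]
    convert hw t using 1
    ext <;> simp [φ, slide]
  let O : Set Heis := {c | |c.1| < 1 / 10 ∧ |c.2.1| < 1 / 10 ∧ |c.2.2 - 1 / 2| < 1 / 10}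
  have hO : IsOpen O := by
    have a1 : Continuous fun c : Heis => |c.1| := by fun_prop
    have a2 : Continuous fun c : Heis => |c.2.1| := by fun_prop
    have a3 : Continuous fun c : Heis => |c.2.2 - 1 / 2| := by fun_prop
    exact (isOpen_lt a1 continuous_const).inter
      ((isOpen_lt a2 continuous_const).inter (isOpen_lt a3 continuous_const))
  have hsub : ψ ⁻¹' O ⊆ B := by
    rintro q ⟨hq1, hq2, hq3⟩
    have := mem_of_abs_lt hB' h0 h1 hq1 hq2 hq3
    rw [mem_preimage] at this
    rwa [← hφψ q]
  have hint : φ (0, 0, 1 / 2) ∈ interior B := by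
    refine mem_interior.2 ⟨_, hsub, hO.preimage hψ, ?_⟩
    rw [mem_preimage, hψφ]
    simp [O]
  rw [hB.interior_eq] at hint
  exact hint

/-- Two lines contained in `B` with independent directions meet. -/
lemma exists_slide_eq (hB : IsLinearlyClosed B) {p q : Heis} {v w : ℝ × ℝ}
    (hvw : v.1 * w.2 - v.2 * w.1 ≠ 0) (hv : ∀ t : ℝ, slide p (t • v) ∈ B)
    (hw : ∀ t : ℝ, slide q (t • w) ∈ B) : ∃ s t : ℝ, slide p (s • v) = slide q (t • w) := by
  set d := v.1 * w.2 - v.2 * w.1 with hd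
  set s := ((q.1 - p.1) * w.2 - (q.2.1 - p.2.1) * w.1) / d with hs
  set t := ((q.1 - p.1) * v.2 - (q.2.1 - p.2.1) * v.1) / d with ht
  have e1 : (slide p (s • v)).1 = (slide q (t • w)).1 := by
    simp [slide, hs, ht]; field_simp; rw [hd]; ring
  have e2 : (slide p (s • v)).2.1 = (slide q (t • w)).2.1 := by
    simp [slide, hs, ht]; field_simp; rw [hd]; ring
  have := hB.eq_zero_of_lines (slide p (s • v)) v w
    ((slide q (t • w)).2.2 - (slide p (s • v)).2.2) hvw
    (fun r => by rw [slide_slide_smul]; exact hv _)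
    (fun r => by
      rw [e1, e2, add_sub_cancel, slide_slide_smul]; exact hw _)
  exact ⟨s, t, Prod.ext e1 (Prod.ext e2 (sub_eq_zero.1 this).symm)⟩

/-- Two parallel lines contained in `B` lie over the same line of the plane. -/
lemma eq_zero_of_parallel (hB : IsLinearlyClosed B) {p q : Heis} {v : ℝ × ℝ} (hv0 : v ≠ 0)
    (hv : ∀ t : ℝ, slide p (t • v) ∈ B) (hw : ∀ t : ℝ, slide q (t • v) ∈ B) :
    (q.1 - p.1) * v.2 - (q.2.1 - p.2.1) * v.1 = 0 := by
  by_contra hne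
  set c := (q.1 - p.1) * v.2 - (q.2.1 - p.2.1) * v.1 with hc
  set e : ℝ × ℝ := (q.1 - p.1, q.2.1 - p.2.1) with he
  set k := (q.2.2 - p.2.2 - (p.1 * q.2.1 - p.2.1 * q.1)) / c with hk
  have hkc : k * c = q.2.2 - p.2.2 - (p.1 * q.2.1 - p.2.1 * q.1) := div_mul_cancel₀ _ hne
  have hjoin : ∀ s t : ℝ, slide (slide p (s • v)) (t • (e - (2 * s + k) • v)) ∈ B := by
    intro s
    refine hB.slide_mem _ (hv s) _ ?_
    convert hw (-s - k) using 1
    ext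
    · simp [slide, he]; ring
    · simp [slide, he]; ring
    · simp [slide, he]; linear_combination hkc - k * hc
  have hd : (e - (2 * 0 + k) • v).1 * (e - (2 * 1 + k) • v).2 -
      (e - (2 * 0 + k) • v).2 * (e - (2 * 1 + k) • v).1 = -2 * c := by
    simp [he, hc]; ring
  obtain ⟨s, t, hst⟩ := hB.exists_slide_eq (by rw [hd]; simpa using hne) (hjoin 0) (hjoin 1)
  have h1 := congrArg Prod.fst hst
  have h2 := congrArg (fun x => x.2.1) hst
  have h3 := congrArg (fun x => x.2.2) hst
  simp [slide, he] at h1 h2 h3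
  have hs : s = t := mul_right_cancel₀ hne (by linear_combination v.2 * h1 - v.1 * h2 + (s - t) * hc)
  subst hs
  have ht : s = 0 := (mul_eq_zero.1 (by
    linear_combination s * hc + h3 - p.1 * h2 + p.2.1 * h1 : s * c = 0)).resolve_right hne
  subst ht
  exact hv0 (Prod.ext (by simpa using h1) (by simpa using h2))

lemma lines_of_parallel {v w : ℝ × ℝ} {q : Heis} (hv0 : v ≠ 0) (hw0 : w ≠ 0)
    (hvw : v.1 * w.2 - v.2 * w.1 = 0) (hw : ∀ t : ℝ, slide q (t • w) ∈ B) (t : ℝ) :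
    slide q (t • v) ∈ B := by
  obtain ⟨c, rfl⟩ : ∃ c : ℝ, c • w = v := by
    by_cases h1 : w.1 = 0
    · have h2 : w.2 ≠ 0 := fun h2 => hw0 (Prod.ext h1 h2)
      refine ⟨v.2 / w.2, Prod.ext ?_ ?_⟩
      · simp [h1] at hvw ⊢; exact (hvw.resolve_right h2).symm
      · simp [h2]
    · refine ⟨v.1 / w.1, Prod.ext ?_ ?_⟩
      · simp [h1]
      · simp; field_simp; linarith
  rw [smul_smul]; exact hw _

lemma sub_eq_zero_of_slide_eq {p r : Heis} {u : ℝ × ℝ} (h : p = slide r u) :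
    r.2.2 - p.2.2 - (p.1 * r.2.1 - p.2.1 * r.1) = 0 := by
  subst h; simp [slide]; ring

lemma sub_eq_zero_of_parallel (hB : IsLinearlyClosed B) {p r : Heis} {u v w : ℝ × ℝ}
    (hu0 : u ≠ 0) (hv0 : v ≠ 0) (hvw : v.1 * w.2 - v.2 * w.1 ≠ 0)
    (huv : v.1 * u.2 - v.2 * u.1 = 0)
    (hu : ∀ t : ℝ, slide r (t • u) ∈ B) (hv : ∀ t : ℝ, slide p (t • v) ∈ B)
    (hw : ∀ t : ℝ, slide p (t • w) ∈ B) :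
    r.2.2 - p.2.2 - (p.1 * r.2.1 - p.2.1 * r.1) = 0 := by
  have h0 := hB.eq_zero_of_parallel hv0 hv (lines_of_parallel hv0 hu0 huv hu)
  have huw : w.1 * u.2 - w.2 * u.1 ≠ 0 := by
    intro h
    rcases eq_or_ne u.1 0 with h1 | h1
    · have h2 : u.2 ≠ 0 := fun h2 => hu0 (Prod.ext h1 h2)
      simp only [h1, mul_zero, sub_zero, mul_eq_zero, h2, or_false] at h huv
      exact hvw (by rw [h, huv]; ring)
    · refine hvw (mul_left_cancel₀ h1 ?_)
      linear_combination w.1 * huv - v.1 * h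
  obtain ⟨a, b, hab⟩ := hB.exists_slide_eq huw hw hu
  have h1 := congrArg Prod.fst hab
  have h2 := congrArg (fun x => x.2.1) hab
  simp only [slide, Prod.smul_fst, Prod.smul_snd, smul_eq_mul] at h1 h2
  have ha : a = 0 := by
    refine (mul_eq_zero.1 ?_ : a = 0 ∨ v.1 * w.2 - v.2 * w.1 = 0).resolve_right hvw
    linear_combination v.1 * h2 - v.2 * h1 + b * huv - h0
  subst ha
  rw [zero_smul, slide_zero] at hab
  exact sub_eq_zero_of_slide_eq hab

/-- If every point of `B` lies on a line contained in `B`, then `B` is contained in a plane. -/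
lemma exists_plane (hB : IsLinearlyClosed B)
    (hline : ∀ p ∈ B, ∃ v : ℝ × ℝ, v ≠ 0 ∧ ∀ t : ℝ, slide p (t • v) ∈ B) (hne : B.Nonempty) :
    (∃ p : Heis, ∃ v : ℝ × ℝ, v ≠ 0 ∧
      ∀ q ∈ B, (q.1 - p.1) * v.2 - (q.2.1 - p.2.1) * v.1 = 0) ∨
    ∃ p : Heis, ∀ q ∈ B, q.2.2 - p.2.2 - (p.1 * q.2.1 - p.2.1 * q.1) = 0 := by
  obtain ⟨p₀, hp₀⟩ := hne
  obtain ⟨v, hv0, hv⟩ := hline p₀ hp₀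
  by_cases hpar : ∀ q ∈ B, ∀ w : ℝ × ℝ, w ≠ 0 → (∀ t : ℝ, slide q (t • w) ∈ B) →
      v.1 * w.2 - v.2 * w.1 = 0
  · refine Or.inl ⟨p₀, v, hv0, fun q hq => ?_⟩
    obtain ⟨w, hw0, hw⟩ := hline q hq
    exact hB.eq_zero_of_parallel hv0 hv (lines_of_parallel hv0 hw0 (hpar q hq w hw0 hw) hw)
  · push Not at hpar
    obtain ⟨q, hq, w, hw0, hw, hvw⟩ := hpar
    obtain ⟨s₀, t₀, hst⟩ := hB.exists_slide_eq hvw hv hw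
    set p := slide p₀ (s₀ • v) with hp
    have hv' : ∀ t : ℝ, slide p (t • v) ∈ B := fun t => by rw [hp, slide_slide_smul]; exact hv _
    have hw' : ∀ t : ℝ, slide p (t • w) ∈ B := fun t => by rw [hst, slide_slide_smul]; exact hw _
    refine Or.inr ⟨p, fun r hr => ?_⟩
    obtain ⟨u, hu0, hu⟩ := hline r hr
    by_cases huv : v.1 * u.2 - v.2 * u.1 = 0
    · exact hB.sub_eq_zero_of_parallel hu0 hv0 hvw huv hu hv' hw'
    by_cases huw : w.1 * u.2 - w.2 * u.1 = 0
    · exact hB.sub_eq_zero_of_parallel hu0 hw0 (fun h => hvw (by linarith)) huw hu hw' hv'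
    obtain ⟨a, b, hab⟩ := hB.exists_slide_eq huv hv' hu
    obtain ⟨a', b', hab'⟩ := hB.exists_slide_eq huw hw' hu
    have h1 := congrArg Prod.fst hab
    have h2 := congrArg (fun x => x.2.1) hab
    have h3 := congrArg (fun x => x.2.2) hab
    have h1' := congrArg Prod.fst hab'
    have h2' := congrArg (fun x => x.2.1) hab'
    have h3' := congrArg (fun x => x.2.2) hab'
    simp only [slide, Prod.smul_fst, Prod.smul_snd, smul_eq_mul] at h1 h2 h3 h1' h2' h3'
    have haa : a * a' * (v.1 * w.2 - v.2 * w.1) = 0 := by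
      linear_combination (p.2.1 + a' * w.2) * h1 + (r.1 + b * u.1) * h2'
        - (p.1 + a' * w.1) * h2 - (r.2.1 + b * u.2) * h1' - h3' + h3
    rcases mul_eq_zero.1 ((mul_eq_zero.1 haa).resolve_right hvw) with rfl | rfl
    · rw [zero_smul, slide_zero] at hab
      exact sub_eq_zero_of_slide_eq hab
    · rw [zero_smul, slide_zero] at hab'
      exact sub_eq_zero_of_slide_eq hab'

end IsLinearlyClosed

/-- The affine form on `ℝ³` with linear coefficients `c` and constant term `d`. -/
def affineForm (c : Heis) (d : ℝ) (p : Heis) : ℝ :=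
  c.1 * p.1 + c.2.1 * p.2.1 + c.2.2 * p.2.2 + d

lemma continuous_affineForm (c : Heis) (d : ℝ) : Continuous (affineForm c d) := by
  unfold affineForm; fun_prop

lemma affineForm_neg (c : Heis) (d : ℝ) (p : Heis) :
    affineForm (-c) (-d) p = -affineForm c d p := by
  simp [affineForm]; ring

lemma affineForm_add_smul (c : Heis) (d : ℝ) (p : Heis) (t : ℝ) :
    affineForm c d (p + t • c) = affineForm c d p + t * (c.1 ^ 2 + c.2.1 ^ 2 + c.2.2 ^ 2) := by
  simp [affineForm]; ring

lemma sum_sq_pos {c : Heis} (hc : c ≠ 0) : 0 < c.1 ^ 2 + c.2.1 ^ 2 + c.2.2 ^ 2 := by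
  by_contra h
  refine hc (Prod.ext ?_ (Prod.ext ?_ ?_)) <;>
    simp <;> nlinarith [sq_nonneg c.1, sq_nonneg c.2.1, sq_nonneg c.2.2]

lemma exists_affineForm_pos {c : Heis} (hc : c ≠ 0) (d : ℝ) : ∃ p, 0 < affineForm c d p := by
  refine ⟨0 + ((1 - d) / (c.1 ^ 2 + c.2.1 ^ 2 + c.2.2 ^ 2)) • c, ?_⟩
  rw [affineForm_add_smul, div_mul_cancel₀ _ (sum_sq_pos hc).ne']
  simp [affineForm]

lemma exists_mem_affineForm_pos {c : Heis} (hc : c ≠ 0) (d : ℝ) {O : Set Heis} (hO : IsOpen O)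
    {p : Heis} (hp : p ∈ O) (hp0 : affineForm c d p = 0) : ∃ q ∈ O, 0 < affineForm c d q := by
  have h1 : Tendsto (fun t : ℝ => p + t • c) (𝓝[>] 0) (𝓝 p) := by
    refine (Continuous.tendsto' (by fun_prop) 0 p (by simp)).mono_left nhdsWithin_le_nhds
  obtain ⟨t, ht, ht0⟩ := ((h1.eventually_mem (hO.mem_nhds hp)).and self_mem_nhdsWithin).exists
  refine ⟨_, ht, ?_⟩
  rw [affineForm_add_smul, hp0, zero_add]
  exact mul_pos ht0 (sum_sq_pos hc)

lemma convex_affineForm_pos (c : Heis) (d : ℝ) : Convex ℝ {p | 0 < affineForm c d p} := by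
  intro p hp q hq a b ha hb hab
  simp only [mem_ofPred_eq] at hp hq ⊢
  have : affineForm c d (a • p + b • q) = a * affineForm c d p + b * affineForm c d q := by
    simp [affineForm]; linear_combination (-d) * hab
  rw [this]
  rcases ha.eq_or_lt with rfl | ha
  · rw [zero_add] at hab; subst hab; simpa using hq
  · exact add_pos_of_pos_of_nonneg (mul_pos ha hp) (mul_nonneg hb hq.le)

namespace IsMonotonePair

variable {U V : Set Heis}

lemma isLinearlyClosed (h : IsMonotonePair U V) : IsLinearlyClosed (U ∪ V)ᶜ where
  interior_eq := by
    refine Set.eq_empty_of_forall_notMem fun p hp => interior_subset hp (Or.inl ?_)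
    exact h.subset_left _ isOpen_interior
      (disjoint_compl_left.mono interior_subset subset_union_right) hp
  slide_mem _ hp _ hv t := h.slide_smul_mem_boundary hp hv t

lemma exists_affineForm (h : IsMonotonePair U V) (hne : ((U ∪ V)ᶜ).Nonempty) :
    ∃ c : Heis, ∃ d, c ≠ 0 ∧ ∀ p ∈ (U ∪ V)ᶜ, affineForm c d p = 0 := by
  rcases h.isLinearlyClosed.exists_plane (fun p hp => h.exists_slide_mem_boundary hp) hne with
    ⟨p, v, hv, H⟩ | ⟨p, H⟩
  · refine ⟨(v.2, -v.1, 0), -p.1 * v.2 + p.2.1 * v.1, fun h0 => hv ?_, fun q hq => ?_⟩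
    · simp at h0; exact Prod.ext h0.2 h0.1
    · have := H q hq
      simp only [affineForm]
      linear_combination this
  · refine ⟨(p.2.1, -p.1, 1), -p.2.2, by simp, fun q hq => ?_⟩
    have := H q hq
    simp only [affineForm]
    linear_combination this

lemma eq_of_subset (h : IsMonotonePair U V) {c : Heis} {d : ℝ} (hc : c ≠ 0)
    (hU : {p | 0 < affineForm c d p} ⊆ U) (hV : {p | 0 < affineForm (-c) (-d) p} ⊆ V) :
    U = {p | 0 < affineForm c d p} := by
  refine Subset.antisymm (fun p hp => ?_) hU
  by_contra h0
  rw [mem_ofPred_eq] at h0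
  rcases (not_lt.1 h0).eq_or_lt with h1 | h1
  · obtain ⟨q, hq, hq0⟩ := exists_mem_affineForm_pos (neg_ne_zero.2 hc) (-d) h.isOpen_left hp
      (by rw [affineForm_neg, h1, neg_zero])
    exact Set.disjoint_left.1 h.disjoint hq (hV hq0)
  · exact Set.disjoint_left.1 h.disjoint hp (hV (by
      rw [mem_ofPred_eq, affineForm_neg]; linarith))

lemma eq_empty_of_subset (h : IsMonotonePair U V) {c : Heis} {d : ℝ} (hc : c ≠ 0)
    (hU : {p | 0 < affineForm c d p} ⊆ U) (hU' : {p | 0 < affineForm (-c) (-d) p} ⊆ U) :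
    V = ∅ := by
  refine Set.eq_empty_of_forall_notMem fun p hp => ?_
  have hpU : p ∉ U := Set.disjoint_right.1 h.disjoint hp
  have h1 : ¬ 0 < affineForm c d p := fun h => hpU (hU h)
  have h2 : ¬ 0 < affineForm (-c) (-d) p := fun h => hpU (hU' h)
  rw [affineForm_neg] at h2
  obtain ⟨q, hq, hq0⟩ := exists_mem_affineForm_pos hc d h.isOpen_right hp (by linarith)
  exact Set.disjoint_left.1 h.disjoint (hU hq0) hq

/-- Classification of monotone pairs of open sets. -/
lemma eq_empty_or_eq_affineForm (h : IsMonotonePair U V) :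
    U = ∅ ∨ V = ∅ ∨ ∃ c : Heis, ∃ d, c ≠ 0 ∧ U = {p | 0 < affineForm c d p} := by
  rcases Set.eq_empty_or_nonempty (U ∪ V)ᶜ with he | hne
  · rw [compl_empty_iff] at he
    rcases isPreconnected_univ.subset_or_subset h.isOpen_left h.isOpen_right h.disjoint he.ge with
      h1 | h1
    · exact Or.inr (Or.inl (by simpa [univ_subset_iff.1 h1] using h.disjoint))
    · exact Or.inl (by simpa [univ_subset_iff.1 h1] using h.disjoint)
  · obtain ⟨c, d, hc, hcd⟩ := h.exists_affineForm hne
    have hsub : ∀ p, affineForm c d p ≠ 0 → p ∈ U ∪ V := fun p hp => by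
      by_contra h0; exact hp (hcd p h0)
    have h1 : {p | 0 < affineForm c d p} ⊆ U ∨ {p | 0 < affineForm c d p} ⊆ V :=
      (convex_affineForm_pos c d).isPreconnected.subset_or_subset h.isOpen_left
      h.isOpen_right h.disjoint fun p hp => hsub p (ne_of_gt hp)
    have h2 := (convex_affineForm_pos (-c) (-d)).isPreconnected.subset_or_subset h.isOpen_left
      h.isOpen_right h.disjoint fun p (hp : 0 < affineForm (-c) (-d) p) => hsub p (by
        rw [affineForm_neg] at hp; linarith)
    rcases h1 with h1 | h1 <;> rcases h2 with h2 | h2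
    · exact Or.inr (Or.inl (h.eq_empty_of_subset hc h1 h2))
    · exact Or.inr (Or.inr ⟨c, d, hc, h.eq_of_subset hc h1 h2⟩)
    · exact Or.inr (Or.inr ⟨-c, -d, neg_ne_zero.2 hc,
        h.eq_of_subset (neg_ne_zero.2 hc) h2 (by simpa using h1)⟩)
    · exact Or.inl (h.symm.eq_empty_of_subset hc h1 h2)

end IsMonotonePair

/-- The coordinates `(a, b, 2 * c - a * b)`, in which horizontal lines are straight. -/
def straighten : Heis ≃ₜ Heis where
  toFun p := (p.1, p.2.1, 2 * p.2.2 - p.1 * p.2.1)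
  invFun p := (p.1, p.2.1, (p.2.2 + p.1 * p.2.1) / 2)
  left_inv p := by simp
  right_inv p := by ext <;> simp; ring
  continuous_toFun := by fun_prop
  continuous_invFun := by fun_prop

lemma straighten_apply (p : Heis) :
    straighten p = (p.1, p.2.1, 2 * p.2.2 - p.1 * p.2.1) := rfl

lemma straighten_symm_apply (p : Heis) :
    straighten.symm p = (p.1, p.2.1, (p.2.2 + p.1 * p.2.1) / 2) := rfl

/-- Right translation of `p` by the horizontal element with projection `v`. -/
def hSlide (p : Heis) (v : ℝ × ℝ) : Heis := hMul p (v.1, v.2, v.1 * v.2 / 2)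

lemma hMul_eq_hSlide (p : Heis) (a b t : ℝ) :
    hMul p (t * a, t * b, t ^ 2 * a * b / 2) = hSlide p (t • (a, b)) := by
  simp [hSlide, hMul]; ring

lemma straighten_hSlide (p : Heis) (v : ℝ × ℝ) :
    straighten (hSlide p v) = slide (straighten p) v := by
  ext
  · simp [straighten, hSlide, hMul, slide]
  · simp [straighten, hSlide, hMul, slide]
  · simp [straighten, hSlide, hMul, slide]; ring

lemma mem_horizPlane_iff {g p : Heis} : p ∈ horizPlane g ↔
    p.2.2 * 2 - p.1 * p.2.1 - (g.2.2 * 2 - g.1 * g.2.1) - (g.1 * p.2.1 - g.2.1 * p.1) = 0 := by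
  constructor
  · rintro ⟨_, ⟨g', a, b, -, rfl⟩, ⟨s, rfl⟩, ⟨t, rfl⟩⟩
    simp [hMul]; ring
  · intro h
    by_cases h0 : p.1 - g.1 = 0 ∧ p.2.1 - g.2.1 = 0
    · refine ⟨hLine g 1 0, ⟨g, 1, 0, by simp, rfl⟩, ⟨0, by simp [hMul]⟩, ⟨0, ?_⟩⟩
      obtain ⟨h1, h2⟩ := h0
      rw [sub_eq_zero] at h1 h2
      ext
      · simp [hMul, h1]
      · simp [hMul, h2]
      · rw [h1, h2] at h; simp [hMul]; linarith
    · refine ⟨hLine g _ _, ⟨g, _, _, h0, rfl⟩, ⟨0, by simp [hMul]⟩, ⟨1, ?_⟩⟩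
      ext
      · simp [hMul]
      · simp [hMul]
      · simp [hMul]; linarith

lemma isPlane_affineForm {c : Heis} (hc : c ≠ 0) (d : ℝ) :
    IsPlane {p | affineForm c d (straighten p) = 0} := by
  by_cases h2 : c.2.2 = 0
  · left
    have hn : c.1 ^ 2 + c.2.1 ^ 2 ≠ 0 := by
      have := sum_sq_pos hc; rw [h2] at this; simpa using this.ne'
    refine ⟨_, ⟨(-d / (c.1 ^ 2 + c.2.1 ^ 2)) • (c.1, c.2.1), (c.2.1, -c.1),
      fun h0 => hc ?_, rfl⟩, ?_⟩
    · simp at h0; exact Prod.ext h0.2 (Prod.ext h0.1 h2)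
    · ext p
      simp only [affineForm, straighten_apply, mem_ofPred_eq, mem_preimage, hPi, h2, Prod.smul_mk,
        smul_eq_mul, Prod.mk_add_mk, Prod.mk.injEq]
      constructor
      · intro h
        refine ⟨(p.1 * c.2.1 - p.2.1 * c.1) / (c.1 ^ 2 + c.2.1 ^ 2), ?_, ?_⟩
        · field_simp; linear_combination c.1 * h
        · field_simp; linear_combination c.2.1 * h
      · rintro ⟨t, h1, h3⟩
        rw [h1, h3]; field_simp; ring
  · right
    refine ⟨straighten.symm (-c.2.1 / c.2.2, c.1 / c.2.2, -d / c.2.2), ?_⟩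
    ext p
    rw [mem_horizPlane_iff]
    simp only [affineForm, straighten_apply, straighten_symm_apply, mem_ofPred_eq]
    constructor
    · intro h
      field_simp
      linear_combination c.2.2 * h
    · intro h
      field_simp at h
      refine mul_left_cancel₀ h2 ?_
      linear_combination h

lemma isHalfSpace_affineForm {c : Heis} (hc : c ≠ 0) (d : ℝ) :
    IsHalfSpace {p | 0 < affineForm c d (straighten p)} := by
  obtain ⟨x, hx⟩ := exists_affineForm_pos hc d
  have hcont : Continuous fun p => affineForm c d (straighten p) :=
    (continuous_affineForm c d).comp straighten.continuous
  have hxp : 0 < affineForm c d (straighten (straighten.symm x)) := by simpa using hx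
  refine ⟨_, straighten.symm x, isPlane_affineForm hc d, hxp.ne', ?_⟩
  refine Subset.antisymm (IsPreconnected.subset_connectedComponentIn ?_ hxp
    fun p hp => ne_of_gt hp) ?_
  · exact straighten.isPreconnected_preimage.2 (convex_affineForm_pos c d).isPreconnected
  · refine isPreconnected_connectedComponentIn.subset_left_of_subset_union
      (isOpen_lt continuous_const hcont) (isOpen_lt hcont continuous_const)
      (Set.disjoint_left.2 fun p (h1 : 0 < affineForm c d (straighten p)) h2 => h1.not_gt h2)
      (fun p hp => ?_)
      ⟨_, mem_connectedComponentIn hxp.ne', hxp⟩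
    exact (lt_or_gt_of_ne (connectedComponentIn_subset _ _ hp)).symm

lemma IsMonotoneSubsetR.compl {S : Set ℝ} (h : IsMonotoneSubsetR S) : IsMonotoneSubsetR Sᶜ := by
  simp only [IsMonotoneSubsetR, measure_symmDiff_eq_zero_iff] at h ⊢
  rcases h with h | h | ⟨r, h | h⟩
  · exact Or.inr (Or.inl (by simpa using h.compl))
  · exact Or.inl (by simpa using h.compl)
  · refine Or.inr (Or.inr ⟨r, Or.inr (h.compl.trans ?_)⟩)
    rw [compl_Ioi]; exact Iio_ae_eq_Iic.symm
  · refine Or.inr (Or.inr ⟨r, Or.inl (h.compl.trans ?_)⟩)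
    rw [compl_Iio]; exact Ioi_ae_eq_Ici.symm

lemma IsMonotoneSubsetR.exists_ordConnected {S : Set ℝ} (h : IsMonotoneSubsetR S) :
    ∃ I : Set ℝ, IsOpen I ∧ I.OrdConnected ∧ S =ᵐ[volume] I := by
  simp only [IsMonotoneSubsetR, measure_symmDiff_eq_zero_iff] at h
  rcases h with h | h | ⟨r, h | h⟩
  · exact ⟨_, isOpen_empty, ordConnected_empty, h⟩
  · exact ⟨_, isOpen_univ, ordConnected_univ, h⟩
  · exact ⟨_, isOpen_Ioi, ordConnected_Ioi, h⟩
  · exact ⟨_, isOpen_Iio, ordConnected_Iio, h⟩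

lemma ae_real_prod {P : ℝ → Prop} (h : ∀ᵐ t, P t) :
    ∀ᵐ x : ℝ × ℝ, P (x.1 + x.2) ∧ P (x.1 - x.2) ∧ P x.1 := by
  have h1 := (quasiMeasurePreserving_add volume volume).ae h
  have h2 := (quasiMeasurePreserving_sub volume volume).ae h
  have h3 := (Measure.quasiMeasurePreserving_fst (μ := volume) (ν := (volume : Measure ℝ))).ae h
  filter_upwards [h1, h2, h3] with x h1 h2 h3 using ⟨h1, h2, h3⟩

lemma IsMonotoneSubsetR.ae_mem {S : Set ℝ} (h : IsMonotoneSubsetR S) :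
    ∀ᵐ x : ℝ × ℝ, x.1 + x.2 ∈ S → x.1 - x.2 ∈ S → x.1 ∈ S := by
  obtain ⟨I, -, hI, hSI⟩ := h.exists_ordConnected
  filter_upwards [ae_real_prod hSI.mem_iff] with x ⟨h1, h2, h3⟩ h4 h5
  rw [h1] at h4
  rw [h2] at h5
  rw [h3]
  rcases le_total 0 x.2 with h0 | h0
  · exact hI.out h5 h4 ⟨by linarith, by linarith⟩
  · exact hI.out h4 h5 ⟨by linarith, by linarith⟩

lemma IsMonotoneSubsetR.ae_notMem {S T : Set ℝ} (h : IsMonotoneSubsetR S) (hT : T ⊆ S)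
    (hST : ∀ᵐ x : ℝ × ℝ, x.1 ∈ T → x.1 + x.2 ∈ S → x.1 - x.2 ∉ S) : ∀ᵐ t, t ∉ T := by
  obtain ⟨I, hIo, -, hSI⟩ := h.exists_ordConnected
  have h1 : ∀ᵐ x : ℝ × ℝ, ¬ (x.1 ∈ T ∧ x.1 + x.2 ∈ I ∧ x.1 - x.2 ∈ I) := by
    filter_upwards [hST, ae_real_prod hSI.mem_iff] with x hx ⟨h1, h2, h3⟩ ⟨h4, h5, h6⟩
    exact hx h4 (h1.2 h5) (h2.2 h6)
  filter_upwards [Measure.ae_ae_of_ae_prod h1, hSI.mem_iff] with t ht hSI htT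
  have htI : t ∈ I := hSI.1 (hT htT)
  have hopen : IsOpen {s : ℝ | t + s ∈ I ∧ t - s ∈ I} :=
    (hIo.preimage (by fun_prop)).inter (hIo.preimage (by fun_prop))
  refine (hopen.measure_pos volume ⟨0, by simp [htI]⟩).ne' (measure_eq_zero_iff_ae_notMem.2 ?_)
  filter_upwards [ht] with s hs h0 using hs ⟨htT, h0⟩

namespace MeasureTheory

variable {α β γ δ : Type*} [MeasurableSpace α] [MeasurableSpace β] [MeasurableSpace γ]
  [MeasurableSpace δ] {μa : Measure α} {μb : Measure β} {μc : Measure γ} {μd : Measure δ}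

lemma Measure.QuasiMeasurePreserving.skew_product [SFinite μc] [SFinite μd] {f : α → β}
    (hf : QuasiMeasurePreserving f μa μb) {g : α → γ → δ} (hgm : Measurable (Function.uncurry g))
    (hg : ∀ᵐ a ∂μa, QuasiMeasurePreserving (g a) μc μd) :
    QuasiMeasurePreserving (fun p : α × γ => (f p.1, g p.1 p.2)) (μa.prod μc) (μb.prod μd) := by
  have hm : Measurable fun p : α × γ => (f p.1, g p.1 p.2) :=
    (hf.1.comp measurable_fst).prodMk hgm
  refine ⟨hm, Measure.AbsolutelyContinuous.mk fun s hs h0 => ?_⟩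
  rw [Measure.map_apply hm hs, Measure.measure_prod_null (hm hs)]
  filter_upwards [hf.ae ((Measure.measure_prod_null hs).1 h0), hg] with a ha hga
  exact hga.preimage_null ha

end MeasureTheory

lemma quasiMeasurePreserving_affine {m : ℝ} (hm : m ≠ 0) (k : ℝ) :
    Measure.QuasiMeasurePreserving (fun t : ℝ => m * t + k) volume volume :=
  (measurePreserving_add_right volume k).quasiMeasurePreserving.comp
    (Measure.quasiMeasurePreserving_smul volume hm)

lemma hSlide_hSlide_smul (p : Heis) (v : ℝ × ℝ) (s t : ℝ) :
    hSlide (hSlide p (s • v)) (t • v) = hSlide p ((s + t) • v) := by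
  ext <;> simp [hSlide, hMul] <;> ring

@[simp] lemma hSlide_zero (p : Heis) : hSlide p 0 = p := by
  ext <;> simp [hSlide, hMul]

lemma continuous_hSlide : Continuous fun x : Heis × (ℝ × ℝ) => hSlide x.1 x.2 := by
  unfold hSlide hMul; fun_prop

@[fun_prop] lemma Continuous.hSlide {X : Type*} [TopologicalSpace X] {f : X → Heis}
    {g : X → ℝ × ℝ} (hf : Continuous f) (hg : Continuous g) :
    Continuous fun x => hSlide (f x) (g x) :=
  continuous_hSlide.comp (hf.prodMk hg)

@[fun_prop] lemma Measurable.hSlide {X : Type*} [MeasurableSpace X] {f : X → Heis}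
    {g : X → ℝ × ℝ} (hf : Measurable f) (hg : Measurable g) :
    Measurable fun x => hSlide (f x) (g x) :=
  continuous_hSlide.measurable.comp (hf.prodMk hg)

lemma measurePreserving_hSlide (v : ℝ × ℝ) :
    MeasurePreserving (fun p : Heis => hSlide p v) volume volume :=
  (measurePreserving_add_right (volume : Measure ℝ) v.1).skew_product
    (g := fun a (q : ℝ × ℝ) => (q.1 + v.2, q.2 + v.1 * v.2 / 2 + a * v.2)) (by fun_prop)
    (Eventually.of_forall fun a => by
      simpa [Prod.add_def, add_assoc] using
        map_add_right_eq_self (volume : Measure (ℝ × ℝ)) (v.2, v.1 * v.2 / 2 + a * v.2))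

lemma measurePreserving_hMul (p : Heis) :
    MeasurePreserving (fun q : Heis => hMul p q) volume volume :=
  (measurePreserving_add_left (volume : Measure ℝ) p.1).skew_product
    (g := fun _ (q : ℝ × ℝ) => (p.2.1 + q.1, p.2.2 + q.2 + p.1 * q.1)) (by fun_prop)
    (Eventually.of_forall fun _ =>
      ((measurePreserving_add_left (volume : Measure ℝ) p.2.1).skew_product
        (g := fun b c => p.2.2 + c + p.1 * b) (by fun_prop) (Eventually.of_forall fun b => by
          simpa [add_right_comm] using
            map_add_left_eq_self (volume : Measure ℝ) (p.2.2 + p.1 * b))).map_eq)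

/-- Moving a point along a line and rescaling the direction is quasi-measure-preserving. -/
lemma quasiMeasurePreserving_hSlide_smul (τ : ℝ) {σ : ℝ} (hσ : σ ≠ 0) :
    Measure.QuasiMeasurePreserving
      (fun x : Heis × (ℝ × ℝ) => (hSlide x.1 (τ • x.2), σ • x.2)) volume volume := by
  have h1 : Measure.QuasiMeasurePreserving
      (fun x : (ℝ × ℝ) × Heis => (σ • x.1, hSlide x.2 (τ • x.1)))
      (volume.prod volume) (volume.prod volume) :=
    (Measure.quasiMeasurePreserving_smul volume hσ).skew_product
      (g := fun v p => hSlide p (τ • v)) (by unfold Function.uncurry; fun_prop)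
      (Eventually.of_forall fun v => (measurePreserving_hSlide _).quasiMeasurePreserving)
  exact (Measure.measurePreserving_swap.quasiMeasurePreserving.comp h1).comp
    Measure.measurePreserving_swap.quasiMeasurePreserving

lemma ae_hSlide {P : Heis → Prop} (h : ∀ᵐ p, P p) (τ : ℝ) :
    ∀ᵐ x : Heis × (ℝ × ℝ), P (hSlide x.1 (τ • x.2)) :=
  (quasiMeasurePreserving_hSlide_smul τ one_ne_zero).ae
    ((Measure.quasiMeasurePreserving_fst (ν := (volume : Measure (ℝ × ℝ)))).ae h)

lemma ae_ae_hSlide_smul_comm {B : Set (Heis × (ℝ × ℝ))} (hB : MeasurableSet B) :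
    (∀ᵐ x : Heis × (ℝ × ℝ), ∀ᵐ y : ℝ × ℝ, (hSlide x.1 (y.1 • x.2), y.2 • x.2) ∈ B) ↔
      ∀ᵐ y : ℝ × ℝ, ∀ᵐ x : Heis × (ℝ × ℝ), (hSlide x.1 (y.1 • x.2), y.2 • x.2) ∈ B := by
  have hm : Measurable fun z : (Heis × (ℝ × ℝ)) × (ℝ × ℝ) =>
    (hSlide z.1.1 (z.2.1 • z.1.2), z.2.2 • z.1.2) := by fun_prop
  exact Measure.ae_ae_comm (p := fun (x : Heis × (ℝ × ℝ)) (y : ℝ × ℝ) =>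
    (hSlide x.1 (y.1 • x.2), y.2 • x.2) ∈ B) (hm hB)

lemma ae_of_ae_hSlide_smul {B : Set (Heis × (ℝ × ℝ))} (hB : MeasurableSet B)
    (h : ∀ᵐ x : Heis × (ℝ × ℝ), ∀ᵐ y : ℝ × ℝ, (hSlide x.1 (y.1 • x.2), y.2 • x.2) ∈ B) :
    ∀ᵐ x, x ∈ B := by
  rw [ae_ae_hSlide_smul_comm hB] at h
  have h0 : ∀ᵐ y : ℝ × ℝ, y.2 ≠ 0 :=
    (Measure.quasiMeasurePreserving_snd (μ := (volume : Measure ℝ))).ae (Measure.ae_ne volume 0)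
  obtain ⟨y, hy, hy0⟩ := (h.and h0).exists
  filter_upwards [(quasiMeasurePreserving_hSlide_smul (-(y.1 / y.2)) (inv_ne_zero hy0)).ae hy]
    with x hx
  have h1 : y.1 • y.2⁻¹ • x.2 = (y.1 / y.2) • x.2 := by rw [smul_smul, div_eq_mul_inv]
  rwa [h1, hSlide_hSlide_smul, smul_inv_smul₀ hy0, neg_add_cancel, zero_smul, hSlide_zero] at hx

/-- Almost every horizontal line meets `E` in a monotone set. -/
def IsMonotoneAE (E : Set Heis) : Prop :=
  ∀ᵐ x : Heis × (ℝ × ℝ), IsMonotoneSubsetR {t | hSlide x.1 (t • x.2) ∈ E}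

/-- The horizontal directions `v` for which `p` is the midpoint of a segment of direction `v` with
endpoints in `E`. -/
def spread (E : Set Heis) (p : Heis) : Set (ℝ × ℝ) :=
  {v | hSlide p v ∈ E ∧ hSlide p (-v) ∈ E}

lemma measurableSet_prod_spread {E : Set Heis} (hE : MeasurableSet E) :
    MeasurableSet {x : Heis × (ℝ × ℝ) | x.2 ∈ spread E x.1} :=
  (hE.preimage (f := fun x : Heis × (ℝ × ℝ) => hSlide x.1 x.2) (by fun_prop)).inter
    (hE.preimage (f := fun x : Heis × (ℝ × ℝ) => hSlide x.1 (-x.2)) (by fun_prop))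

lemma measurable_volume_spread {E : Set Heis} (hE : MeasurableSet E) :
    Measurable fun p => volume (spread E p) :=
  measurable_measure_prodMk_left (measurableSet_prod_spread hE)

/-- The two-step version of `spread`. -/
def tree (E : Set Heis) (p : Heis) : Set ((ℝ × ℝ) × (ℝ × ℝ) × (ℝ × ℝ)) :=
  {θ | θ.2.1 ∈ spread E (hSlide p θ.1) ∧ θ.2.2 ∈ spread E (hSlide p (-θ.1))}

lemma measurableSet_tree {E : Set Heis} (hE : MeasurableSet E) (p : Heis) :
    MeasurableSet (tree E p) :=
  ((measurableSet_prod_spread hE).preimage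
    (f := fun θ : (ℝ × ℝ) × (ℝ × ℝ) × (ℝ × ℝ) => (hSlide p θ.1, θ.2.1)) (by fun_prop)).inter
    ((measurableSet_prod_spread hE).preimage
    (f := fun θ : (ℝ × ℝ) × (ℝ × ℝ) × (ℝ × ℝ) => (hSlide p (-θ.1), θ.2.2)) (by fun_prop))

namespace IsMonotoneAE

variable {E : Set Heis}

lemma compl (h : IsMonotoneAE E) : IsMonotoneAE Eᶜ := by
  filter_upwards [h] with x hx using hx.compl

lemma ae_mem_of_mem_spread (h : IsMonotoneAE E) (hE : MeasurableSet E) :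
    ∀ᵐ x : Heis × (ℝ × ℝ), x.2 ∈ spread E x.1 → x.1 ∈ E := by
  refine ae_of_ae_hSlide_smul (B := {x | x.2 ∈ spread E x.1 → x.1 ∈ E})
    ((measurableSet_prod_spread hE).imp (hE.preimage measurable_fst)) ?_
  filter_upwards [h] with x hx
  filter_upwards [hx.ae_mem] with y hy
  rintro ⟨h1, h2⟩
  rw [← neg_smul] at h2
  rw [hSlide_hSlide_smul] at h1 h2
  exact hy h1 h2

lemma ae_volume_spread_ne_zero (h : IsMonotoneAE E) (hE : MeasurableSet E) :
    ∀ᵐ p, p ∈ E → volume (spread E p) ≠ 0 := by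
  set N : Set Heis := {p | p ∈ E ∧ volume (spread E p) = 0} with hN
  have hNm : MeasurableSet N :=
    hE.inter (measurable_volume_spread hE (measurableSet_singleton 0))
  have hB : MeasurableSet {x : Heis × (ℝ × ℝ) | x.1 ∈ N → x.2 ∉ spread E x.1} :=
    (hNm.preimage measurable_fst).imp (measurableSet_prod_spread hE).compl
  have h1 : ∀ᵐ x : Heis × (ℝ × ℝ), x.1 ∈ N → x.2 ∉ spread E x.1 := by
    refine (Measure.ae_prod_iff_ae_ae hB).2 ?_
    refine Eventually.of_forall fun p => ?_
    by_cases hp : p ∈ N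
    · filter_upwards [measure_eq_zero_iff_ae_notMem.1 hp.2] with v hv _ using hv
    · exact Eventually.of_forall fun v hpN => absurd hpN hp
  have h2 : ∀ᵐ x : Heis × (ℝ × ℝ), ∀ᵐ y : ℝ × ℝ, hSlide x.1 (y.1 • x.2) ∈ N →
      y.2 • x.2 ∉ spread E (hSlide x.1 (y.1 • x.2)) := by
    refine (ae_ae_hSlide_smul_comm hB).2 ?_
    have h0 : ∀ᵐ y : ℝ × ℝ, y.2 ≠ 0 :=
      (Measure.quasiMeasurePreserving_snd (μ := (volume : Measure ℝ))).ae (Measure.ae_ne volume 0)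
    filter_upwards [h0] with y hy
    exact (quasiMeasurePreserving_hSlide_smul y.1 hy).ae h1
  have h3 : ∀ᵐ x : Heis × (ℝ × ℝ), x ∈ {x : Heis × (ℝ × ℝ) | x.1 ∉ N} := by
    refine ae_of_ae_hSlide_smul (hNm.compl.preimage measurable_fst) ?_
    filter_upwards [h, h2] with x hx hx2
    refine (Measure.quasiMeasurePreserving_fst (ν := (volume : Measure ℝ))).ae
      (hx.ae_notMem (T := {t | hSlide x.1 (t • x.2) ∈ N}) (fun t ht => ht.1) ?_)
    filter_upwards [hx2] with y hy h4 h5 h6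
    refine hy h4 ⟨?_, ?_⟩
    · rw [hSlide_hSlide_smul]; exact h5
    · rw [← neg_smul, hSlide_hSlide_smul]; exact h6
  have h4 : ∀ᵐ p : Heis, ∀ᵐ _ : ℝ × ℝ, p ∉ N := Measure.ae_ae_of_ae_prod h3
  filter_upwards [h4] with p hp h5 h6
  exact hp.exists.choose_spec ⟨h5, h6⟩

lemma ae_mem_iff_volume_spread (h : IsMonotoneAE E) (hE : MeasurableSet E) :
    ∀ᵐ p, p ∈ E ↔ volume (spread E p) ≠ 0 := by
  filter_upwards [h.ae_volume_spread_ne_zero hE, Measure.ae_ae_of_ae_prod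
    (h.ae_mem_of_mem_spread hE)] with p h1 h2
  refine ⟨h1, fun h3 => ?_⟩
  by_contra h4
  refine h3 (measure_eq_zero_iff_ae_notMem.2 ?_)
  filter_upwards [h2] with v hv h5 using h4 (hv h5)

lemma ae_mem_iff_volume_tree (h : IsMonotoneAE E) (hE : MeasurableSet E) :
    ∀ᵐ p, p ∈ E ↔ volume (tree E p) ≠ 0 := by
  have h1 := h.ae_mem_iff_volume_spread hE
  filter_upwards [h1, Measure.ae_ae_of_ae_prod (ae_hSlide h1 1),
    Measure.ae_ae_of_ae_prod (ae_hSlide h1 (-1))] with p h2 h3 h4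
  rw [h2, not_iff_not, Measure.volume_eq_prod (ℝ × ℝ) ((ℝ × ℝ) × (ℝ × ℝ)),
    Measure.measure_prod_null (measurableSet_tree hE p),
    measure_eq_zero_iff_ae_notMem]
  refine eventually_congr ?_
  filter_upwards [h3, h4] with v h5 h6
  rw [one_smul] at h5
  rw [neg_smul, one_smul] at h6
  have h7 : Prod.mk v ⁻¹' tree E p = spread E (hSlide p v) ×ˢ spread E (hSlide p (-v)) := rfl
  rw [h7, Measure.volume_eq_prod, Measure.prod_prod, Pi.zero_apply, mul_eq_zero, spread,
    mem_ofPred_eq, h5, h6]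
  tauto

end IsMonotoneAE

lemma quasiMeasurePreserving_hSlide_hSlide_zero :
    Measure.QuasiMeasurePreserving
      (fun x : (ℝ × ℝ) × (ℝ × ℝ) => hSlide (hSlide 0 x.1) x.2) volume volume := by
  have h0 : ∀ᵐ s : ℝ × ℝ, s.1 ≠ 0 :=
    (Measure.quasiMeasurePreserving_fst (ν := (volume : Measure ℝ))).ae (Measure.ae_ne volume 0)
  have h1 : Measure.QuasiMeasurePreserving
      (fun x : (ℝ × ℝ) × (ℝ × ℝ) => (x.1, (x.1.1 * x.1.2 - x.1.1 * x.2.2 + x.2.1 * x.1.2) / 2))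
      (volume.prod volume) (volume.prod volume) := by
    refine (Measure.QuasiMeasurePreserving.id volume).skew_product
      (g := fun (s v : ℝ × ℝ) => (s.1 * s.2 - s.1 * v.2 + v.1 * s.2) / 2)
      (by unfold Function.uncurry; fun_prop) ?_
    filter_upwards [h0] with s hs
    refine QuasiMeasurePreserving.prod_of_right (by fun_prop) (Eventually.of_forall
      fun a => ?_)
    have e : (fun b : ℝ => (s.1 * s.2 - s.1 * b + a * s.2) / 2) =
        fun b => -s.1 / 2 * b + (s.1 * s.2 + a * s.2) / 2 := by
      funext b
      ring
    change Measure.QuasiMeasurePreserving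
      (fun b : ℝ => (s.1 * s.2 - s.1 * b + a * s.2) / 2) volume volume
    rw [e]
    exact quasiMeasurePreserving_affine (div_ne_zero (neg_ne_zero.2 hs) two_ne_zero) _
  have h2 : Measure.QuasiMeasurePreserving
      (fun x : (ℝ × ℝ) × (ℝ × ℝ) => (x.1 + x.2, x.1)) volume volume :=
    (Measure.measurePreserving_swap.comp
      (measurePreserving_prod_add (volume : Measure (ℝ × ℝ)) volume)).quasiMeasurePreserving
  have h3 := (measurePreserving_prodAssoc (volume : Measure ℝ) (volume : Measure ℝ)
    (volume : Measure ℝ)).quasiMeasurePreserving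
  have h4 : (fun x : (ℝ × ℝ) × (ℝ × ℝ) => hSlide (hSlide 0 x.1) x.2) =
      MeasurableEquiv.prodAssoc ∘ (fun x : (ℝ × ℝ) × (ℝ × ℝ) =>
        (x.1, (x.1.1 * x.1.2 - x.1.1 * x.2.2 + x.2.1 * x.1.2) / 2)) ∘ fun x => (x.1 + x.2, x.1) := by
    funext x
    ext <;> simp [hSlide, hMul, MeasurableEquiv.prodAssoc]
    ring
  rw [h4]
  exact h3.comp (h1.comp h2)

lemma hSlide_hSlide (p : Heis) (v w : ℝ × ℝ) :
    hSlide (hSlide p v) w = hMul p (hSlide (hSlide 0 v) w) := by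
  ext <;> simp [hSlide, hMul] <;> ring

/-- The four endpoints of the two-step tree at the origin. -/
def leaf : Fin 4 → (ℝ × ℝ) × (ℝ × ℝ) × (ℝ × ℝ) → Heis :=
  ![fun θ => hSlide (hSlide 0 θ.1) θ.2.1, fun θ => hSlide (hSlide 0 θ.1) (-θ.2.1),
    fun θ => hSlide (hSlide 0 (-θ.1)) θ.2.2, fun θ => hSlide (hSlide 0 (-θ.1)) (-θ.2.2)]

lemma mem_tree_iff {E : Set Heis} {p : Heis} {θ : (ℝ × ℝ) × (ℝ × ℝ) × (ℝ × ℝ)} :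
    θ ∈ tree E p ↔ ∀ i, hMul p (leaf i θ) ∈ E := by
  simp [Fin.forall_fin_succ, leaf, tree, spread, ← hSlide_hSlide, and_assoc]

lemma quasiMeasurePreserving_leaf (i : Fin 4) :
    Measure.QuasiMeasurePreserving (leaf i) volume volume := by
  have hf : Measure.QuasiMeasurePreserving
      (fun θ : (ℝ × ℝ) × (ℝ × ℝ) × (ℝ × ℝ) => (θ.1, θ.2.1)) volume volume :=
    (Measure.QuasiMeasurePreserving.id volume).skew_product
      (g := fun (_ : ℝ × ℝ) (w : (ℝ × ℝ) × (ℝ × ℝ)) => w.1)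
      (by unfold Function.uncurry; fun_prop)
      (Eventually.of_forall fun _ => Measure.quasiMeasurePreserving_fst)
  have hs : Measure.QuasiMeasurePreserving
      (fun θ : (ℝ × ℝ) × (ℝ × ℝ) × (ℝ × ℝ) => (θ.1, θ.2.2)) volume volume :=
    (Measure.QuasiMeasurePreserving.id volume).skew_product
      (g := fun (_ : ℝ × ℝ) (w : (ℝ × ℝ) × (ℝ × ℝ)) => w.2)
      (by unfold Function.uncurry; fun_prop)
      (Eventually.of_forall fun _ => Measure.quasiMeasurePreserving_snd)
  have hn := quasiMeasurePreserving_neg (volume : Measure (ℝ × ℝ))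
  have hnr : Measure.QuasiMeasurePreserving
      (fun x : (ℝ × ℝ) × (ℝ × ℝ) => (x.1, -x.2)) volume volume :=
    (Measure.QuasiMeasurePreserving.id volume).skew_product
      (g := fun _ w : ℝ × ℝ => -w) (by unfold Function.uncurry; fun_prop)
      (Eventually.of_forall fun _ => hn)
  have hnl : Measure.QuasiMeasurePreserving
      (fun x : (ℝ × ℝ) × (ℝ × ℝ) => (-x.1, x.2)) volume volume :=
    hn.skew_product (g := fun _ w : ℝ × ℝ => w) (by unfold Function.uncurry; fun_prop)
      (Eventually.of_forall fun _ => Measure.QuasiMeasurePreserving.id volume)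
  have h := quasiMeasurePreserving_hSlide_hSlide_zero
  fin_cases i
  · exact h.comp hf
  · exact h.comp (hnr.comp hf)
  · exact h.comp (hnl.comp hs)
  · exact h.comp (hnr.comp (hnl.comp hs))

lemma MeasureTheory.Measure.AbsolutelyContinuous.tendsto_measure_zero {α ι : Type*}
    [MeasurableSpace α] {μ ν : Measure α} [IsFiniteMeasure μ] [SigmaFinite ν] (h : μ ≪ ν)
    {l : Filter ι} {s : ι → Set α} (hs : Tendsto (fun i => ν (s i)) l (𝓝 0)) :
    Tendsto (fun i => μ (s i)) l (𝓝 0) := by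
  have := tendsto_setLIntegral_zero (Measure.lintegral_rnDeriv_lt_top μ ν).ne hs
  simpa only [Measure.setLIntegral_rnDeriv h] using this

lemma tendsto_measure_symmDiff_hMul_preimage {α : Type*} [MeasurableSpace α] {ν : Measure α}
    [IsFiniteMeasure ν] {g : α → Heis} (hg : Measure.QuasiMeasurePreserving g ν volume)
    {F : Set Heis} (hF : MeasurableSet F) (hF0 : volume F ≠ ⊤) (p₀ : Heis) :
    Tendsto (fun p => ν (g ⁻¹' (symmDiff (hMul p ⁻¹' F) (hMul p₀ ⁻¹' F)))) (𝓝 p₀) (𝓝 0) := by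
  have hc : Continuous fun x : Heis × Heis => hMul x.1 x.2 := by unfold hMul; fun_prop
  let T : C(Heis, C(Heis, Heis)) := ContinuousMap.curry ⟨_, hc⟩
  have h1 : Tendsto (fun p => volume (symmDiff (hMul p ⁻¹' F) (hMul p₀ ⁻¹' F))) (𝓝 p₀) (𝓝 0) :=
    tendsto_measure_symmDiff_preimage_nhds_zero (f := T) (g := T p₀) (T.continuous.tendsto p₀)
      (Eventually.of_forall measurePreserving_hMul) (measurePreserving_hMul p₀)
      hF.nullMeasurableSet hF0
  have h2 := hg.absolutelyContinuous.tendsto_measure_zero h1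
  refine h2.congr fun p => Measure.map_apply hg.measurable ?_
  exact ((measurePreserving_hMul p).measurable hF).symmDiff
    ((measurePreserving_hMul p₀).measurable hF)

lemma isOpen_setOf_volume_tree_ne_zero {E : Set Heis} (hE : MeasurableSet E) :
    IsOpen {p | volume (tree E p) ≠ 0} := by
  rw [isOpen_iff_mem_nhds]
  intro p₀ hp₀
  let ν := (volume : Measure ((ℝ × ℝ) × (ℝ × ℝ) × (ℝ × ℝ))).toFinite
  have hν : ν ≪ volume := toFinite_absolutelyContinuous _
  let F : ℕ → Set Heis := fun n => E ∩ spanningSets volume n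
  have hFm : ∀ n, MeasurableSet (F n) := fun n => hE.inter (measurableSet_spanningSets _ _)
  have hFmono : Monotone F := fun m n h => inter_subset_inter_right _ (monotone_spanningSets _ h)
  obtain ⟨n, hn⟩ : ∃ n, ν (tree (F n) p₀) ≠ 0 := by
    by_contra! h0
    refine hp₀ (absolutelyContinuous_toFinite _ (measure_mono_null ?_ (measure_iUnion_null h0)))
    intro θ hθ
    rw [mem_tree_iff] at hθ
    have : ∀ i, ∃ n, hMul p₀ (leaf i θ) ∈ spanningSets volume n := fun i => by
      rw [← mem_iUnion, iUnion_spanningSets]; trivial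
    choose N hN using this
    refine mem_iUnion.2 ⟨Finset.univ.sup N, mem_tree_iff.2 fun i => ⟨hθ i, ?_⟩⟩
    exact monotone_spanningSets _ (Finset.le_sup (Finset.mem_univ i)) (hN i)
  have h1 : Tendsto (fun p => ∑ i, ν (leaf i ⁻¹' (symmDiff (hMul p ⁻¹' F n) (hMul p₀ ⁻¹' F n)))) (𝓝 p₀)
      (𝓝 0) := by
    have := tendsto_finsetSum Finset.univ fun i _ => tendsto_measure_symmDiff_hMul_preimage
      ((quasiMeasurePreserving_leaf i).mono_left hν) (hFm n)
      ((measure_mono inter_subset_right).trans_lt (measure_spanningSets_lt_top volume n)).ne p₀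
    simpa using this
  filter_upwards [h1.eventually_lt_const (pos_iff_ne_zero.2 hn)] with p hp h0
  refine hp.not_ge ?_
  have hsub : tree (F n) p₀ ⊆
      tree E p ∪ ⋃ i, leaf i ⁻¹' (symmDiff (hMul p ⁻¹' F n) (hMul p₀ ⁻¹' F n)) := by
    intro θ hθ
    by_cases hp : θ ∈ tree E p
    · exact Or.inl hp
    · rw [mem_tree_iff] at hp hθ
      push Not at hp
      obtain ⟨i, hi⟩ := hp
      exact Or.inr (mem_iUnion.2 ⟨i, Or.inr ⟨hθ i, fun h => hi h.1⟩⟩)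
  calc ν (tree (F n) p₀) ≤ _ := measure_mono hsub
    _ ≤ _ := measure_union_le _ _
    _ ≤ _ := add_le_add (hν h0).le (measure_iUnion_fintype_le _ _)
    _ = _ := zero_add _

/-- The points near which `E` has full measure. -/
def fullInterior (E : Set Heis) : Set Heis :=
  {p | ∃ O, IsOpen O ∧ p ∈ O ∧ volume (O ∩ Eᶜ) = 0}

lemma isOpen_fullInterior (E : Set Heis) : IsOpen (fullInterior E) := by
  rw [isOpen_iff_forall_mem_open]
  rintro p ⟨O, hO, hp, h0⟩
  exact ⟨O, fun q hq => ⟨O, hO, hq, h0⟩, hO, hp⟩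

lemma volume_fullInterior_inter_compl (E : Set Heis) : volume (fullInterior E ∩ Eᶜ) = 0 := by
  refine measure_null_of_locally_null _ ?_
  rintro p ⟨⟨O, hO, hp, h0⟩, -⟩
  have hsub : fullInterior E ∩ Eᶜ ∩ O ⊆ O ∩ Eᶜ := fun q hq => ⟨hq.2, hq.1.2⟩
  exact ⟨_, inter_mem_nhdsWithin _ (hO.mem_nhds hp), measure_mono_null hsub h0⟩

lemma fullInterior_ae_eq {E O : Set Heis} (hO : IsOpen O) (h : E =ᵐ[volume] O) :
    fullInterior E =ᵐ[volume] E := by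
  rw [ae_eq_set] at h ⊢
  have hsub : E \ fullInterior E ⊆ E \ O := fun p hp => ⟨hp.1, fun hpO => hp.2 ⟨O, hO, hpO, h.2⟩⟩
  exact ⟨volume_fullInterior_inter_compl E, measure_mono_null hsub h.1⟩

lemma disjoint_fullInterior_compl (E : Set Heis) :
    Disjoint (fullInterior E) (fullInterior Eᶜ) := by
  refine Set.disjoint_left.2 ?_
  rintro p ⟨O, hO, hp, h0⟩ ⟨O', hO', hp', h0'⟩
  refine ((hO.inter hO').measure_pos volume ⟨p, hp, hp'⟩).ne' ?_
  refine measure_mono_null (fun q hq => ?_) (measure_union_null h0 h0')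
  by_cases hqE : q ∈ E
  · exact Or.inr ⟨hq.2, fun h => h hqE⟩
  · exact Or.inl ⟨hq.1, hqE⟩

lemma subset_fullInterior {E W : Set Heis} (hE : fullInterior Eᶜ =ᵐ[volume] Eᶜ) (hW : IsOpen W)
    (h : Disjoint W (fullInterior Eᶜ)) : W ⊆ fullInterior E := by
  refine fun p hp => ⟨W, hW, hp, measure_mono_null (fun q hq => ?_) (ae_eq_set.1 hE).2⟩
  exact ⟨hq.2, Set.disjoint_left.1 h hq.1⟩

namespace IsMonotoneAE

variable {E : Set Heis}

lemma fullInterior_ae_eq (h : IsMonotoneAE E) (hE : MeasurableSet E) :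
    fullInterior E =ᵐ[volume] E := by
  refine _root_.fullInterior_ae_eq (isOpen_setOf_volume_tree_ne_zero hE) ?_
  exact eventuallyEq_set.2 (h.ae_mem_iff_volume_tree hE)

lemma notMem_fullInterior_compl (h : IsMonotoneAE E) (hE : MeasurableSet E) {p : Heis}
    {v : ℝ × ℝ} {s t : ℝ} (hs : s < 0) (ht : 0 < t) (hps : hSlide p (s • v) ∈ fullInterior E)
    (hpt : hSlide p (t • v) ∈ fullInterior E) : p ∉ fullInterior Eᶜ := by
  intro hp
  set U := fullInterior E
  set V := fullInterior Eᶜ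
  have hU : IsOpen U := isOpen_fullInterior E
  have hV : IsOpen V := isOpen_fullInterior Eᶜ
  have hUV : Disjoint U V := disjoint_fullInterior_compl E
  have hUE : ∀ᵐ q, q ∈ E ↔ q ∈ U := eventuallyEq_set.1 (h.fullInterior_ae_eq hE).symm
  have hUEm : MeasurableSet {q | q ∈ E ↔ q ∈ U} := hE.iff hU.measurableSet
  have h1 : ∀ᵐ x : Heis × (ℝ × ℝ), ∀ᵐ y : ℝ × ℝ,
      hSlide x.1 (y.1 • x.2) ∈ E ↔ hSlide x.1 (y.1 • x.2) ∈ U :=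
    (ae_ae_hSlide_smul_comm (B := {x | x.1 ∈ E ↔ x.1 ∈ U}) (hUEm.preimage measurable_fst)).2
      (Eventually.of_forall fun y => ae_hSlide hUE y.1)
  have hO : IsOpen {x : Heis × (ℝ × ℝ) | (hSlide x.1 (s • x.2) ∈ U ∧ hSlide x.1 (t • x.2) ∈ U) ∧
      x.1 ∈ V} :=
    ((hU.preimage (by fun_prop)).inter (hU.preimage (by fun_prop))).inter
      (hV.preimage continuous_fst)
  have hfreq := frequently_ae_mem_iff.2 (hO.measure_pos volume ⟨(p, v), ⟨hps, hpt⟩, hp⟩).ne'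
  obtain ⟨x, ⟨⟨hxs, hxt⟩, hx0⟩, hx, hxE⟩ := (hfreq.and_eventually (h.and h1)).exists
  obtain ⟨I, hIo, hI, hSI⟩ := hx.exists_ordConnected
  have hIU : ∀ᵐ r : ℝ, r ∈ I ↔ hSlide x.1 (r • x.2) ∈ U := by
    have hxE : ∀ᵐ r : ℝ, ∀ᵐ _ : ℝ, hSlide x.1 (r • x.2) ∈ E ↔ hSlide x.1 (r • x.2) ∈ U :=
      Measure.ae_ae_of_ae_prod hxE
    filter_upwards [hxE, hSI.mem_iff] with r hr hr'
    rw [← hr', ← hr.exists.choose_spec]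
  have hc : Continuous fun r : ℝ => hSlide x.1 (r • x.2) := by fun_prop
  have key : ∀ J : Set ℝ, IsOpen J → (∃ r ∈ J, hSlide x.1 (r • x.2) ∈ U) → ∃ r ∈ J, r ∈ I := by
    rintro J hJ ⟨r, hrJ, hrU⟩
    have := frequently_ae_mem_iff.2
      ((hJ.inter (hU.preimage hc)).measure_pos volume ⟨r, hrJ, hrU⟩).ne'
    obtain ⟨r, ⟨hrJ, hrU⟩, hr⟩ := (this.and_eventually hIU).exists
    exact ⟨r, hrJ, hr.2 hrU⟩
  obtain ⟨a, ha, haI⟩ := key (Iio 0) isOpen_Iio ⟨s, hs, hxs⟩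
  obtain ⟨b, hb, hbI⟩ := key (Ioi 0) isOpen_Ioi ⟨t, ht, hxt⟩
  have h0I : (0 : ℝ) ∈ I := hI.out haI hbI ⟨le_of_lt ha, le_of_lt hb⟩
  have := frequently_ae_mem_iff.2
    ((hIo.inter (hV.preimage hc)).measure_pos volume ⟨0, h0I, by simpa using hx0⟩).ne'
  obtain ⟨r, ⟨hrI, hrV⟩, hr⟩ := (this.and_eventually hIU).exists
  exact Set.disjoint_left.1 hUV (hr.1 hrI) hrV

lemma isMonotonePair (h : IsMonotoneAE E) (hE : MeasurableSet E) :
    IsMonotonePair (straighten.symm ⁻¹' fullInterior E)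
      (straighten.symm ⁻¹' fullInterior Eᶜ) := by
  have hslide : ∀ p v, straighten.symm (slide p v) = hSlide (straighten.symm p) v := fun p v => by
    rw [Homeomorph.symm_apply_eq, straighten_hSlide, Homeomorph.apply_symm_apply]
  have hsub : ∀ {A W : Set Heis}, fullInterior Aᶜ =ᵐ[volume] Aᶜ → IsOpen W →
      Disjoint W (straighten.symm ⁻¹' fullInterior Aᶜ) → W ⊆ straighten.symm ⁻¹' fullInterior A := by
    intro A W hA hW hd
    rw [← image_subset_iff]
    refine subset_fullInterior hA (straighten.symm.isOpenMap W hW) ?_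
    rwa [Set.disjoint_image_left]
  refine ⟨(isOpen_fullInterior E).preimage straighten.symm.continuous,
    (isOpen_fullInterior Eᶜ).preimage straighten.symm.continuous,
    (disjoint_fullInterior_compl E).preimage _,
    fun W hW hd => hsub (h.compl.fullInterior_ae_eq hE.compl) hW hd,
    fun W hW hd => hsub (A := Eᶜ) ?_ hW ?_, ?_, ?_⟩
  · have : ∀ B, B = E → fullInterior B =ᵐ[volume] B := by
      rintro _ rfl
      exact h.fullInterior_ae_eq hE
    exact this _ (compl_compl E)
  · rwa [compl_compl]
  · intro p v s hs t ht h1 h2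
    rw [mem_preimage, hslide] at h1 h2
    exact h.notMem_fullInterior_compl hE hs ht h1 h2
  · intro p v s hs t ht h1 h2 h3
    rw [mem_preimage, hslide] at h1 h2
    exact h.compl.notMem_fullInterior_compl hE.compl hs ht h1 h2 (by rwa [compl_compl])

end IsMonotoneAE

/-- Classification of monotone subsets of the Heisenberg group: if for a.e.
parametrized line the trace of `E` on it is a monotone subset of `ℝ`, then up to a
Lebesgue-null set, `E` is `∅`, `H`, or a half-space. -/
theorem statement17 (E : Set Heis) (hmeas : MeasurableSet E)
    (hmono : ∀ᵐ x ∂(volume : Measure (Heis × (ℝ × ℝ))),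
      IsMonotoneSubsetR
        {t : ℝ | hMul x.1 (t * x.2.1, t * x.2.2, t ^ 2 * x.2.1 * x.2.2 / 2) ∈ E}) :
    volume (symmDiff E (∅ : Set Heis)) = 0 ∨
    volume (symmDiff E (Set.univ : Set Heis)) = 0 ∨
    ∃ C : Set Heis, IsHalfSpace C ∧ volume (symmDiff E C) = 0 := by
  have h : IsMonotoneAE E := by
    simp only [hMul_eq_hSlide, Prod.mk.eta] at hmono
    exact hmono
  have hU := h.fullInterior_ae_eq hmeas
  have hV := h.compl.fullInterior_ae_eq hmeas.compl
  simp only [measure_symmDiff_eq_zero_iff]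
  rcases (h.isMonotonePair hmeas).eq_empty_or_eq_affineForm with h0 | h0 | ⟨c, d, hc, h0⟩
  · rw [Set.preimage_eq_empty_iff, straighten.symm.surjective.range_eq, disjoint_univ] at h0
    rw [h0] at hU
    exact Or.inl hU.symm
  · rw [Set.preimage_eq_empty_iff, straighten.symm.surjective.range_eq, disjoint_univ] at h0
    rw [h0] at hV
    exact Or.inr (Or.inl (by simpa using hV.symm.compl))
  · refine Or.inr (Or.inr ⟨_, isHalfSpace_affineForm hc d, hU.symm.trans (Eq.eventuallyEq ?_)⟩)
    rw [← preimage_id (s := fullInterior E), ← straighten.symm_comp_self, preimage_comp, h0]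
    rfl
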